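/- Let (Z,ρ₀) be an antipodal space. Then the metric space M(Z) is contractible. Explicitly, for any ρ₁ ∈ M(Z), the map H : M(Z) × [0,1] → M(Z), H(ρ,t) := P_∞(t·log(dρ/dρ₁), ρ₁), is a continuous homotopy with H(ρ,1) = ρ and H(ρ,0) = ρ₁ for all ρ ∈ M(Z). -/

import Mathlib

open Filter Topology
open scoped Classical

variable {Z : Type*}

/-- `Z` has at least four points. -/
def HasFourPoints (Z : Type*) : Prop :=
  ∃ a b c d : Z, a ≠ b ∧ a ≠ c ∧ a ≠ d ∧ b ≠ c ∧ b ≠ d ∧ c ≠ d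

/-- A separating function on `Z`: continuous, symmetric, and positive. -/
structure IsSeparating [TopologicalSpace Z] (ρ : Z → Z → ℝ) : Prop where
  continuous : Continuous fun p : Z × Z => ρ p.1 p.2
  symm : ∀ ξ η, ρ ξ η = ρ η ξ
  nonneg : ∀ ξ η, 0 ≤ ρ ξ η
  eq_zero_iff : ∀ ξ η, ρ ξ η = 0 ↔ ξ = η

/-- The cross-ratio of a quadruple of points with respect to `ρ`. -/
noncomputable def crossRatio (ρ : Z → Z → ℝ) (ξ ξ' η η' : Z) : ℝ :=
  ρ ξ η * ρ ξ' η' / (ρ ξ η' * ρ ξ' η)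

/-- Two functions are Moebius equivalent if their cross-ratios agree on all quadruples
of pairwise distinct points. -/
def MoebiusEquiv (ρ₁ ρ₂ : Z → Z → ℝ) : Prop :=
  ∀ ξ ξ' η η' : Z, ξ ≠ ξ' → ξ ≠ η → ξ ≠ η' → ξ' ≠ η → ξ' ≠ η' → η ≠ η' →
    crossRatio ρ₁ ξ ξ' η η' = crossRatio ρ₂ ξ ξ' η η'

/-- An antipodal function on `Z`: a separating function with values in `[0,1]` such that
every point has an antipode. -/
structure IsAntipodal [TopologicalSpace Z] (ρ : Z → Z → ℝ) : Prop where
  toIsSeparating : IsSeparating ρ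
  le_one : ∀ ξ η, ρ ξ η ≤ 1
  antipode : ∀ ξ, ∃ η, ρ ξ η = 1

/-- The Moebius space `M(Z, ρ₀)`: antipodal functions Moebius equivalent to `ρ₀`. -/
def MoebiusSpace [TopologicalSpace Z] (ρ₀ : Z → Z → ℝ) : Set (Z → Z → ℝ) :=
  {ρ | IsAntipodal ρ ∧ MoebiusEquiv ρ₀ ρ}

/-- The derivative `dρ₂/dρ₁`: the (unique, when it exists) positive continuous function
satisfying the geometric mean value theorem
`ρ₂(ξ,η)² = f(ξ) f(η) ρ₁(ξ,η)²`. -/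
noncomputable def mDeriv [TopologicalSpace Z] (ρ₁ ρ₂ : Z → Z → ℝ) : Z → ℝ :=
  if h : ∃ f : Z → ℝ, Continuous f ∧ (∀ ξ, 0 < f ξ) ∧
      ∀ ξ η, ρ₂ ξ η ^ 2 = f ξ * f η * ρ₁ ξ η ^ 2
  then h.choose else fun _ => 1

/-- The metric `d_M(ρ₁, ρ₂) = ‖log (dρ₂/dρ₁)‖_∞` on the Moebius space. -/
noncomputable def dM [TopologicalSpace Z] (ρ₁ ρ₂ : Z → Z → ℝ) : ℝ :=
  ⨆ ξ : Z, |Real.log (mDeriv ρ₁ ρ₂ ξ)|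

/-- The discrepancy function `D_{ρ₁}(τ)(ξ) = max_{η ≠ ξ} (τ(ξ) + τ(η) + log ρ₁(ξ,η)²)`. -/
noncomputable def discrepancy [TopologicalSpace Z] (ρ₁ : Z → Z → ℝ) (τ : C(Z, ℝ))
    (ξ : Z) : ℝ :=
  ⨆ η : {η : Z // η ≠ ξ}, (τ ξ + τ η.1 + Real.log (ρ₁ ξ η.1 ^ 2))

/-- `E_{ρ₁}(τ)(ξ,η) = e^{τ(ξ)/2} e^{τ(η)/2} ρ₁(ξ,η)`. -/
noncomputable def eMap [TopologicalSpace Z] (ρ₁ : Z → Z → ℝ) (τ : C(Z, ℝ)) :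
    Z → Z → ℝ :=
  fun ξ η => Real.exp (τ ξ / 2) * Real.exp (τ η / 2) * ρ₁ ξ η

/-- A solution of the `ρ₁`-antipodal flow `dτ_t/dt = -D_{ρ₁}(τ_t)` on `[0, ∞)`. -/
def IsAntipodalFlowSol [TopologicalSpace Z] [CompactSpace Z]
    (ρ₁ : Z → Z → ℝ) (τ : ℝ → C(Z, ℝ)) : Prop :=
  ∀ t ∈ Set.Ici (0 : ℝ), ∃ τ' : C(Z, ℝ),
    (∀ ξ, τ' ξ = -discrepancy ρ₁ (τ t) ξ) ∧
    HasDerivWithinAt τ τ' (Set.Ici (0 : ℝ)) t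

/-- The antipodalization map `P_∞(τ₀, ρ₁) = E_{ρ₁}(τ_∞)`, where `τ_∞` is the limit as
`t → ∞` of the solution of the `ρ₁`-antipodal flow starting at `τ₀`. -/
noncomputable def antipodalization [TopologicalSpace Z] [CompactSpace Z]
    (ρ₁ : Z → Z → ℝ) (τ₀ : C(Z, ℝ)) : Z → Z → ℝ :=
  if h : ∃ p : (ℝ → C(Z, ℝ)) × C(Z, ℝ), p.1 0 = τ₀ ∧ IsAntipodalFlowSol ρ₁ p.1 ∧
      Filter.Tendsto p.1 Filter.atTop (𝓝 p.2)
  then eMap ρ₁ h.choose.2 else ρ₁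

lemma norm_integral_le_exp {E : Type*} [NormedAddCommGroup E] [NormedSpace ℝ E]
    {w : ℝ → E} {C l t : ℝ} (hC : 0 ≤ C) (hl : 0 < l) (ht : 0 ≤ t)
    (hw : ∀ s, 0 ≤ s → ‖w s‖ ≤ C * Real.exp (l * s)) :
    ‖∫ s in (0 : ℝ)..t, w s‖ ≤ C / l * Real.exp (l * t) := by
  have hint : ∫ s in (0 : ℝ)..t, C * Real.exp (l * s)
      = C / l * Real.exp (l * t) - C / l * Real.exp (l * 0) := by
    refine intervalIntegral.integral_eq_sub_of_hasDerivAt (f := fun s => C / l * Real.exp (l * s))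
      (fun s _ => ?_) (Continuous.intervalIntegrable (by fun_prop) _ _)
    refine (((hasDerivAt_id s).const_mul l).exp.const_mul (C / l)).congr_deriv ?_
    rw [id]
    field_simp
  have h := intervalIntegral.norm_integral_le_of_norm_le (μ := MeasureTheory.volume) ht
    (f := w) (g := fun s => C * Real.exp (l * s))
    (Filter.Eventually.of_forall fun s hs => hw s hs.1.le)
    (Continuous.intervalIntegrable (by fun_prop) _ _)
  rw [hint] at h
  have : 0 ≤ C / l * Real.exp (l * 0) := by positivity
  linarith

/-- A globally Lipschitz autonomous ODE has a solution on `[0, ∞)`: apply the contraction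
principle for a norm with an exponential weight. -/
lemma LipschitzWith.exists_global_solution {E : Type*} [NormedAddCommGroup E] [NormedSpace ℝ E]
    [CompleteSpace E] {v : E → E} {K : NNReal} (hv : LipschitzWith K v) (x₀ : E) :
    ∃ τ : ℝ → E, τ 0 = x₀ ∧
      ∀ t ∈ Set.Ici (0 : ℝ), HasDerivWithinAt τ (v (τ t)) (Set.Ici 0) t := by
  set l : ℝ := K + 1 with hl_def
  have hl : 0 < l := by positivity
  have hvc := hv.continuous
  have hcont (y : BoundedContinuousFunction ℝ E) :
      Continuous fun s : ℝ => v (Real.exp (l * s) • y s) :=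
    hvc.comp ((by fun_prop : Continuous fun s : ℝ => Real.exp (l * s)).smul y.continuous)
  let F (y : BoundedContinuousFunction ℝ E) (t : ℝ) : E :=
    x₀ + ∫ s in (0 : ℝ)..t, v (Real.exp (l * s) • y s)
  have hF (y : BoundedContinuousFunction ℝ E) (t : ℝ) :
      HasDerivAt (F y) (v (Real.exp (l * t) • y t)) t :=
    ((hcont y).integral_hasStrictDerivAt 0 t).hasDerivAt.const_add x₀
  have hFc (y : BoundedContinuousFunction ℝ E) : Continuous (F y) :=
    continuous_iff_continuousAt.2 fun t => (hF y t).continuousAt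
  have hbound (y : BoundedContinuousFunction ℝ E) (t : ℝ) (ht : 0 ≤ t) :
      ‖Real.exp (-(l * t)) • F y t‖ ≤ ‖x₀‖ + (‖v 0‖ + K * ‖y‖) / l := by
    have hint := norm_integral_le_exp (w := fun s => v (Real.exp (l * s) • y s))
      (C := ‖v 0‖ + K * ‖y‖) (by positivity) hl ht (fun s hs => by
        have h1 : ‖v (Real.exp (l * s) • y s) - v 0‖ ≤ K * (Real.exp (l * s) * ‖y s‖) := by
          simpa [norm_smul] using hv.norm_sub_le (Real.exp (l * s) • y s) 0
        have h2 := norm_le_norm_add_norm_sub' (v (Real.exp (l * s) • y s)) (v 0)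
        have h3 : (1 : ℝ) ≤ Real.exp (l * s) := Real.one_le_exp (by positivity)
        have h4 : K * (Real.exp (l * s) * ‖y s‖) ≤ K * (Real.exp (l * s) * ‖y‖) := by
          gcongr; exact y.norm_coe_le_norm s
        nlinarith [norm_nonneg (v 0)])
    have h1 : ‖F y t‖ ≤ ‖x₀‖ + (‖v 0‖ + K * ‖y‖) / l * Real.exp (l * t) :=
      (norm_add_le _ _).trans (by gcongr)
    have h2 : Real.exp (-(l * t)) ≤ 1 := Real.exp_le_one_iff.2 (by nlinarith)
    have h3 : Real.exp (-(l * t)) * Real.exp (l * t) = 1 := by rw [← Real.exp_add]; simp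
    rw [norm_smul, Real.norm_of_nonneg (Real.exp_pos _).le]
    calc Real.exp (-(l * t)) * ‖F y t‖
        ≤ Real.exp (-(l * t)) * (‖x₀‖ + (‖v 0‖ + K * ‖y‖) / l * Real.exp (l * t)) := by gcongr
      _ = Real.exp (-(l * t)) * ‖x₀‖
          + (‖v 0‖ + K * ‖y‖) / l * (Real.exp (-(l * t)) * Real.exp (l * t)) := by ring
      _ ≤ 1 * ‖x₀‖ + (‖v 0‖ + K * ‖y‖) / l * 1 := by rw [h3]; gcongr
      _ = _ := by ring
  let Φ (y : BoundedContinuousFunction ℝ E) : BoundedContinuousFunction ℝ E :=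
    BoundedContinuousFunction.ofNormedAddCommGroup
      (fun t => Real.exp (-(l * max t 0)) • F y (max t 0))
      ((by fun_prop : Continuous fun t : ℝ => Real.exp (-(l * max t 0))).smul
        ((hFc y).comp (by fun_prop)))
      (‖x₀‖ + (‖v 0‖ + K * ‖y‖) / l) (fun t => hbound y _ (le_max_right _ _))
  have hΦ : ContractingWith (K / (K + 1)) Φ := by
    refine ⟨(div_lt_one (by positivity)).2 (lt_add_one K), LipschitzWith.of_dist_le_mul
      fun y z => ?_⟩
    refine (BoundedContinuousFunction.dist_le (by positivity)).2 fun t => ?_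
    have ht : 0 ≤ max t 0 := le_max_right _ _
    change dist (Real.exp (-(l * max t 0)) • F y (max t 0))
      (Real.exp (-(l * max t 0)) • F z (max t 0)) ≤ _
    generalize max t 0 = t at ht
    have hdiff : F y t - F z t = ∫ s in (0 : ℝ)..t,
        (v (Real.exp (l * s) • y s) - v (Real.exp (l * s) • z s)) := by
      rw [intervalIntegral.integral_sub ((hcont y).intervalIntegrable _ _)
        ((hcont z).intervalIntegrable _ _)]
      simp only [F]
      abel
    have hint := norm_integral_le_exp
      (w := fun s => v (Real.exp (l * s) • y s) - v (Real.exp (l * s) • z s))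
      (C := K * dist y z) (by positivity) hl ht (fun s hs => by
        have h1 := hv.norm_sub_le (Real.exp (l * s) • y s) (Real.exp (l * s) • z s)
        rw [← smul_sub, norm_smul, Real.norm_of_nonneg (Real.exp_pos _).le, ← dist_eq_norm (y s)]
          at h1
        have h2 : K * (Real.exp (l * s) * dist (y s) (z s))
            ≤ K * (Real.exp (l * s) * dist y z) := by
          gcongr; exact BoundedContinuousFunction.dist_coe_le_dist s
        linarith)
    rw [← hdiff] at hint
    have h3 : Real.exp (-(l * t)) * Real.exp (l * t) = 1 := by rw [← Real.exp_add]; simp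
    rw [dist_eq_norm, ← smul_sub, norm_smul, Real.norm_of_nonneg (Real.exp_pos _).le]
    calc Real.exp (-(l * t)) * ‖F y t - F z t‖
        ≤ Real.exp (-(l * t)) * (K * dist y z / l * Real.exp (l * t)) := by gcongr
      _ = K * dist y z / l * (Real.exp (-(l * t)) * Real.exp (l * t)) := by ring
      _ = _ := by rw [h3, hl_def]; push_cast; ring
  obtain ⟨y, hy⟩ : ∃ y, Φ y = y := ⟨_, hΦ.fixedPoint_isFixedPt⟩
  have hyt (t : ℝ) (ht : 0 ≤ t) : Real.exp (l * t) • y t = F y t := by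
    have h1 : Φ y t = Real.exp (-(l * max t 0)) • F y (max t 0) := rfl
    rw [hy, max_eq_left ht] at h1
    rw [h1, smul_smul, ← Real.exp_add]
    simp
  refine ⟨F y, by simp [F], fun t ht => ?_⟩
  have h := hF y t
  rw [hyt t ht] at h
  exact h.hasDerivWithinAt

/-! ### The discrepancy operator -/

section Discrepancy

variable [TopologicalSpace Z] {ρ : Z → Z → ℝ}

lemma IsSeparating.pos (hρ : IsSeparating ρ) {ξ η : Z} (h : ξ ≠ η) : 0 < ρ ξ η :=
  lt_of_le_of_ne (hρ.nonneg ξ η) fun h0 => h ((hρ.eq_zero_iff ξ η).1 h0.symm)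

lemma eMap_sq_eq_exp (hρ : IsSeparating ρ) (τ : C(Z, ℝ)) {ξ η : Z} (h : ξ ≠ η) :
    eMap ρ τ ξ η ^ 2 = Real.exp (τ ξ + τ η + Real.log (ρ ξ η ^ 2)) := by
  have hp := hρ.pos h
  rw [Real.exp_add, Real.exp_add, Real.exp_log (by positivity), eMap, mul_pow, mul_pow,
    ← Real.exp_nat_mul, ← Real.exp_nat_mul]
  congr 3 <;> push_cast <;> ring_nf

lemma continuous_eMap (hρ : IsSeparating ρ) (τ : C(Z, ℝ)) :
    Continuous fun p : Z × Z => eMap ρ τ p.1 p.2 := by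
  have := hρ.continuous
  unfold eMap
  fun_prop

lemma eMap_self (hρ : IsSeparating ρ) (τ : C(Z, ℝ)) (ξ : Z) : eMap ρ τ ξ ξ = 0 := by
  simp [eMap, (hρ.eq_zero_iff ξ ξ).2 rfl]

lemma isSeparating_eMap (hρ : IsSeparating ρ) (τ : C(Z, ℝ)) : IsSeparating (eMap ρ τ) where
  continuous := continuous_eMap hρ τ
  symm ξ η := by simp only [eMap, hρ.symm ξ η]; ring
  nonneg ξ η := by have := hρ.nonneg ξ η; unfold eMap; positivity
  eq_zero_iff ξ η := by simp [eMap, hρ.eq_zero_iff]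

variable [CompactSpace Z]

lemma sub_apply_le_norm_sub (τ σ : C(Z, ℝ)) (ξ : Z) : τ ξ - σ ξ ≤ ‖τ - σ‖ :=
  (le_abs_self _).trans ((τ - σ).norm_coe_le_norm ξ)

variable [Nontrivial Z]

/-- The maximum defining the discrepancy is attained. -/
lemma exists_isMax_discrepancy (hρ : IsSeparating ρ) (τ : C(Z, ℝ)) (ξ : Z) :
    ∃ η, ξ ≠ η ∧ discrepancy ρ τ ξ = τ ξ + τ η + Real.log (ρ ξ η ^ 2) ∧
      ∀ η', ξ ≠ η' → τ ξ + τ η' + Real.log (ρ ξ η' ^ 2) ≤ discrepancy ρ τ ξ := by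
  have hc : Continuous fun η => eMap ρ τ ξ η ^ 2 :=
    ((continuous_eMap hρ τ).comp (Continuous.prodMk_right ξ)).pow 2
  obtain ⟨η, -, hη⟩ := isCompact_univ.exists_isMaxOn Set.univ_nonempty hc.continuousOn
  have hmax (η' : Z) : eMap ρ τ ξ η' ^ 2 ≤ eMap ρ τ ξ η ^ 2 := hη (Set.mem_univ η')
  have hne : ξ ≠ η := by
    rintro rfl
    obtain ⟨ζ, hζ⟩ := exists_ne ξ
    have h1 := hmax ζ
    rw [eMap_self hρ, eMap_sq_eq_exp hρ τ hζ.symm] at h1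
    have := Real.exp_pos (τ ξ + τ ζ + Real.log (ρ ξ ζ ^ 2))
    exact this.not_ge (h1.trans_eq (by norm_num))
  have hle (η' : Z) (h : ξ ≠ η') :
      τ ξ + τ η' + Real.log (ρ ξ η' ^ 2) ≤ τ ξ + τ η + Real.log (ρ ξ η ^ 2) := by
    have h1 := hmax η'
    rwa [eMap_sq_eq_exp hρ τ hne, eMap_sq_eq_exp hρ τ h, Real.exp_le_exp] at h1
  have heq : discrepancy ρ τ ξ = τ ξ + τ η + Real.log (ρ ξ η ^ 2) := by
    have : Nonempty {η : Z // η ≠ ξ} := ⟨⟨η, hne.symm⟩⟩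
    refine le_antisymm (ciSup_le fun η' => hle η'.1 η'.2.symm) ?_
    refine le_ciSup (f := fun η : {η : Z // η ≠ ξ} => τ ξ + τ η.1 + Real.log (ρ ξ η.1 ^ 2))
      ⟨τ ξ + τ η + Real.log (ρ ξ η ^ 2), ?_⟩ ⟨η, hne.symm⟩
    rintro _ ⟨η', rfl⟩
    exact hle η'.1 η'.2.symm
  exact ⟨η, hne, heq, fun η' h => heq ▸ hle η' h⟩

lemma le_discrepancy (hρ : IsSeparating ρ) (τ : C(Z, ℝ)) {ξ η : Z} (h : ξ ≠ η) :
    τ ξ + τ η + Real.log (ρ ξ η ^ 2) ≤ discrepancy ρ τ ξ :=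
  (exists_isMax_discrepancy hρ τ ξ).choose_spec.2.2 η h

lemma continuous_discrepancy (hρ : IsSeparating ρ) (τ : C(Z, ℝ)) :
    Continuous (discrepancy ρ τ) := by
  have hc : Continuous fun ξ => sSup ((fun η => eMap ρ τ ξ η ^ 2) '' Set.univ) :=
    isCompact_univ.continuous_sSup (f := fun ξ η => eMap ρ τ ξ η ^ 2)
      ((continuous_eMap hρ τ).pow 2)
  have heq (ξ : Z) : sSup ((fun η => eMap ρ τ ξ η ^ 2) '' Set.univ)
      = Real.exp (discrepancy ρ τ ξ) := by
    obtain ⟨η, hne, h, hle⟩ := exists_isMax_discrepancy hρ τ ξ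
    refine IsGreatest.csSup_eq ⟨⟨η, Set.mem_univ _, ?_⟩, ?_⟩
    · simp only [eMap_sq_eq_exp hρ τ hne, h]
    · rintro _ ⟨η', -, rfl⟩
      by_cases h' : ξ = η'
      · subst h'
        simpa only [eMap_self hρ, ne_eq, OfNat.ofNat_ne_zero, not_false_eq_true, zero_pow]
          using (Real.exp_pos _).le
      · simp only [eMap_sq_eq_exp hρ τ h']
        exact Real.exp_le_exp.2 (hle η' h')
  have hlog := hc.log fun ξ => by rw [heq]; positivity
  simpa only [heq, Real.log_exp] using hlog

/-- The discrepancy operator on `C(Z)`. -/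
noncomputable def discrepancyMap (hρ : IsSeparating ρ) (τ : C(Z, ℝ)) : C(Z, ℝ) :=
  ⟨discrepancy ρ τ, continuous_discrepancy hρ τ⟩

lemma discrepancyMap_apply (hρ : IsSeparating ρ) (τ : C(Z, ℝ)) (ξ : Z) :
    discrepancyMap hρ τ ξ = discrepancy ρ τ ξ := rfl

/-- The nonlinear part `τ ↦ D(τ) - τ` of the discrepancy operator is nonexpansive. -/
lemma norm_discrepancyMap_sub_sub_le (hρ : IsSeparating ρ) (τ σ : C(Z, ℝ)) :
    ‖(discrepancyMap hρ τ - τ) - (discrepancyMap hρ σ - σ)‖ ≤ ‖τ - σ‖ := by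
  have key (τ σ : C(Z, ℝ)) (ξ : Z) :
      discrepancy ρ τ ξ - τ ξ - (discrepancy ρ σ ξ - σ ξ) ≤ ‖τ - σ‖ := by
    obtain ⟨η, hne, h, -⟩ := exists_isMax_discrepancy hρ τ ξ
    have h1 := le_discrepancy hρ σ hne
    have h2 := sub_apply_le_norm_sub τ σ η
    linarith
  refine (ContinuousMap.norm_le _ (norm_nonneg _)).2 fun ξ => abs_le.2 ⟨?_, key τ σ ξ⟩
  have h := key σ τ ξ
  rw [norm_sub_rev] at h
  simp only [ContinuousMap.sub_apply, discrepancyMap_apply]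
  linarith

lemma lipschitzWith_neg_discrepancyMap (hρ : IsSeparating ρ) :
    LipschitzWith 2 fun τ => -discrepancyMap hρ τ := by
  refine LipschitzWith.of_dist_le_mul fun τ σ => ?_
  rw [dist_neg_neg, dist_eq_norm, dist_eq_norm]
  have h := norm_add_le ((discrepancyMap hρ τ - τ) - (discrepancyMap hρ σ - σ)) (τ - σ)
  have h1 := norm_discrepancyMap_sub_sub_le hρ τ σ
  have h2 : (discrepancyMap hρ τ - τ) - (discrepancyMap hρ σ - σ) + (τ - σ)
      = discrepancyMap hρ τ - discrepancyMap hρ σ := by abel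
  rw [h2] at h
  push_cast
  linarith

/-- `E(τ)` is antipodal exactly when `τ` has zero discrepancy. -/
lemma isAntipodal_eMap_iff (hρ : IsSeparating ρ) (τ : C(Z, ℝ)) :
    IsAntipodal (eMap ρ τ) ↔ discrepancyMap hρ τ = 0 := by
  have hs := isSeparating_eMap hρ τ
  constructor
  · intro h
    ext ξ
    obtain ⟨η, hne, heq, -⟩ := exists_isMax_discrepancy hρ τ ξ
    obtain ⟨ζ, hζ⟩ := h.antipode ξ
    have hξζ : ξ ≠ ζ := by
      rintro rfl
      rw [eMap_self hρ] at hζ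
      exact zero_ne_one hζ
    rw [discrepancyMap_apply, ContinuousMap.zero_apply]
    apply le_antisymm
    · rw [heq, ← Real.exp_le_one_iff, ← eMap_sq_eq_exp hρ τ hne]
      exact pow_le_one₀ (hs.nonneg _ _) (h.le_one _ _)
    · refine le_trans ?_ (le_discrepancy hρ τ hξζ)
      rw [← Real.one_le_exp_iff, ← eMap_sq_eq_exp hρ τ hξζ, hζ, one_pow]
  · intro h
    have h0 (ξ : Z) : discrepancy ρ τ ξ = 0 := by rw [← discrepancyMap_apply hρ, h]; rfl
    refine ⟨hs, fun ξ η => ?_, fun ξ => ?_⟩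
    · by_cases hξη : ξ = η
      · subst hξη
        rw [eMap_self hρ]
        exact zero_le_one
      · have h1 := le_discrepancy hρ τ hξη
        rw [h0, ← Real.exp_le_one_iff, ← eMap_sq_eq_exp hρ τ hξη] at h1
        exact (sq_le_one_iff₀ (hs.nonneg _ _)).1 h1
    · obtain ⟨η, hne, heq, -⟩ := exists_isMax_discrepancy hρ τ ξ
      rw [h0] at heq
      have h1 := eMap_sq_eq_exp hρ τ hne
      rw [← heq, Real.exp_zero] at h1
      exact ⟨η, (pow_eq_one_iff_of_nonneg (hs.nonneg ξ η) two_ne_zero).1 h1⟩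

end Discrepancy

/-! ### The antipodal flow -/

section Flow

variable [TopologicalSpace Z] [CompactSpace Z] {ρ : Z → Z → ℝ}

lemma IsAntipodalFlowSol.hasDerivWithinAt_apply {τ : ℝ → C(Z, ℝ)}
    (hτ : IsAntipodalFlowSol ρ τ) (ξ : Z) {t : ℝ} (ht : 0 ≤ t) :
    HasDerivWithinAt (fun s => τ s ξ) (-discrepancy ρ (τ t) ξ) (Set.Ici 0) t := by
  obtain ⟨τ', h1, h2⟩ := hτ t ht
  rw [← h1]
  exact (ContinuousMap.evalCLM ℝ ξ).hasFDerivAt.comp_hasDerivWithinAt t h2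

variable [Nontrivial Z]

lemma isAntipodalFlowSol_iff (hρ : IsSeparating ρ) {τ : ℝ → C(Z, ℝ)} :
    IsAntipodalFlowSol ρ τ ↔ ∀ t ∈ Set.Ici (0 : ℝ),
      HasDerivWithinAt τ (-discrepancyMap hρ (τ t)) (Set.Ici 0) t := by
  refine forall₂_congr fun t _ => ⟨?_, fun h => ⟨_, fun _ => rfl, h⟩⟩
  rintro ⟨τ', h1, h2⟩
  rwa [show -discrepancyMap hρ (τ t) = τ' from ContinuousMap.ext fun ξ => (h1 ξ).symm]

lemma exists_isAntipodalFlowSol (hρ : IsSeparating ρ) (τ₀ : C(Z, ℝ)) :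
    ∃ τ : ℝ → C(Z, ℝ), τ 0 = τ₀ ∧ IsAntipodalFlowSol ρ τ := by
  obtain ⟨τ, h0, h⟩ := (lipschitzWith_neg_discrepancyMap hρ).exists_global_solution τ₀
  exact ⟨τ, h0, (isAntipodalFlowSol_iff hρ).2 h⟩

/-- The antipodal flow is a semigroup of nonexpansive maps. -/
lemma IsAntipodalFlowSol.norm_sub_le (hρ : IsSeparating ρ) {τ σ : ℝ → C(Z, ℝ)}
    (hτ : IsAntipodalFlowSol ρ τ) (hσ : IsAntipodalFlowSol ρ σ) {t : ℝ} (ht : 0 ≤ t) :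
    ‖τ t - σ t‖ ≤ ‖τ 0 - σ 0‖ := by
  rw [isAntipodalFlowSol_iff hρ] at hτ hσ
  have hd (s : ℝ) (hs : s ∈ Set.Ici (0 : ℝ)) :
      HasDerivWithinAt (fun s => Real.exp s • (τ s - σ s))
        (-(Real.exp s • ((discrepancyMap hρ (τ s) - τ s) - (discrepancyMap hρ (σ s) - σ s))))
        (Set.Ici 0) s := by
    refine ((Real.hasDerivAt_exp s).hasDerivWithinAt.smul
      ((hτ s hs).sub (hσ s hs))).congr_deriv ?_
    simp only [Pi.sub_apply]
    module
  have hg := norm_le_gronwallBound_of_norm_deriv_right_le (f := fun s => Real.exp s • (τ s - σ s))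
    (δ := ‖τ 0 - σ 0‖) (K := 1) (ε := 0) (a := 0) (b := t)
    (fun s hs => ((hd s hs.1).continuousWithinAt).mono fun x hx => hx.1)
    (fun s hs => (hd s hs.1).mono (Set.Ici_subset_Ici.2 hs.1)) (by simp)
    (fun s _ => by
      rw [norm_neg, norm_smul, norm_smul, one_mul, add_zero]
      gcongr
      exact norm_discrepancyMap_sub_sub_le hρ _ _) t ⟨ht, le_rfl⟩
  rw [gronwallBound_ε0, norm_smul, Real.norm_of_nonneg (Real.exp_pos _).le, one_mul, sub_zero,
    mul_comm] at hg
  exact le_of_mul_le_mul_right hg (Real.exp_pos t)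

/-- The positive part of the discrepancy decays like `e^{-2t}` along the flow. -/
lemma IsAntipodalFlowSol.discrepancy_le (hρ : IsSeparating ρ) {τ : ℝ → C(Z, ℝ)}
    (hτ : IsAntipodalFlowSol ρ τ) {t : ℝ} (ht : 0 ≤ t) (ξ : Z) :
    discrepancy ρ (τ t) ξ ≤ ‖discrepancyMap hρ (τ 0)‖ * Real.exp (-(2 * t)) := by
  obtain ⟨η, hne, heq, -⟩ := exists_isMax_discrepancy hρ (τ t) ξ
  have hd (s : ℝ) (hs : s ∈ Set.Ici (0 : ℝ)) :
      HasDerivWithinAt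
        (fun s => Real.exp (2 * s) * (τ s ξ + τ s η + Real.log (ρ ξ η ^ 2)))
        (Real.exp (2 * s) * (2 * (τ s ξ + τ s η + Real.log (ρ ξ η ^ 2))
          - discrepancy ρ (τ s) ξ - discrepancy ρ (τ s) η)) (Set.Ici 0) s := by
    convert! (((hasDerivAt_id s).const_mul 2).exp.hasDerivWithinAt).mul
      (((hτ.hasDerivWithinAt_apply ξ hs).add (hτ.hasDerivWithinAt_apply η hs)).add_const
        (Real.log (ρ ξ η ^ 2))) using 1
    simp only [id, Pi.add_apply]
    ring
  have hanti := antitoneOn_of_hasDerivWithinAt_nonpos (convex_Ici (0 : ℝ))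
    (fun s hs => (hd s hs).continuousWithinAt)
    (fun s hs => (hd s (interior_subset hs)).mono interior_subset)
    (fun s _ => by
      have h1 := le_discrepancy hρ (τ s) hne
      have h2 := le_discrepancy hρ (τ s) hne.symm
      rw [hρ.symm η ξ] at h2
      exact mul_nonpos_of_nonneg_of_nonpos (Real.exp_pos _).le (by linarith))
  have h := hanti Set.self_mem_Ici ht ht
  have h0 := (le_discrepancy hρ (τ 0) hne).trans
    ((le_abs_self _).trans ((discrepancyMap hρ (τ 0)).norm_coe_le_norm ξ))
  simp only [mul_zero, Real.exp_zero, one_mul, ← heq] at h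
  rw [Real.exp_neg, ← div_eq_mul_inv, le_div_iff₀ (Real.exp_pos _)]
  linarith

lemma IsAntipodalFlowSol.le_discrepancy (hρ : IsSeparating ρ) {τ : ℝ → C(Z, ℝ)}
    (hτ : IsAntipodalFlowSol ρ τ) {t : ℝ} (ht : 0 ≤ t) (ξ : Z) :
    -(2 * ‖discrepancyMap hρ (τ 0)‖ * Real.exp (-t)) ≤ discrepancy ρ (τ t) ξ := by
  set M := ‖discrepancyMap hρ (τ 0)‖ with hM
  have hexp2 (c s : ℝ) : HasDerivAt (fun s => Real.exp (c * s)) (c * Real.exp (c * s)) s := by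
    convert! ((hasDerivAt_id s).const_mul c).exp using 1
    simp only [id]
    ring
  have hmono (ζ : Z) : MonotoneOn (fun s => τ s ζ - M / 2 * Real.exp (-2 * s)) (Set.Ici 0) := by
    have hd (s : ℝ) (hs : s ∈ Set.Ici (0 : ℝ)) :
        HasDerivWithinAt (fun s => τ s ζ - M / 2 * Real.exp (-2 * s))
          (-discrepancy ρ (τ s) ζ + M * Real.exp (-(2 * s))) (Set.Ici 0) s := by
      convert! (hτ.hasDerivWithinAt_apply ζ hs).sub
        ((hexp2 (-2) s).const_mul (M / 2)).hasDerivWithinAt using 1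
      ring_nf
    exact monotoneOn_of_hasDerivWithinAt_nonneg (convex_Ici (0 : ℝ))
      (fun s hs => (hd s hs).continuousWithinAt)
      (fun s hs => (hd s (interior_subset hs)).mono interior_subset)
      (fun s hs => by linarith [hτ.discrepancy_le hρ (interior_subset hs : (0 : ℝ) ≤ s) ζ])
  have hu (s : ℝ) (hs : 0 ≤ s) (hst : s ≤ t) : discrepancy ρ (τ s) ξ - τ s ξ
      ≤ discrepancy ρ (τ t) ξ - τ t ξ + M / 2 * Real.exp (-2 * s) := by
    obtain ⟨η, hne, heq, -⟩ := exists_isMax_discrepancy hρ (τ s) ξ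
    have h1 := _root_.le_discrepancy hρ (τ t) hne
    have h2 := hmono η hs ht hst
    have h3 : 0 ≤ M / 2 * Real.exp (-2 * t) := by positivity
    simp only at h2
    linarith
  set u := discrepancy ρ (τ t) ξ - τ t ξ with hu_def
  have hd (s : ℝ) (hs : s ∈ Set.Icc 0 t) :
      HasDerivWithinAt (fun s => Real.exp s * (τ s ξ + u) - M / 2 * Real.exp (-1 * s))
        (Real.exp s * (τ s ξ + u - discrepancy ρ (τ s) ξ) + M / 2 * Real.exp (-1 * s))
        (Set.Icc 0 t) s := by
    convert! ((Real.hasDerivAt_exp s).hasDerivWithinAt.mul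
      (((hτ.hasDerivWithinAt_apply ξ hs.1).mono Set.Icc_subset_Ici_self).add_const u)).sub
        ((hexp2 (-1) s).const_mul (M / 2)).hasDerivWithinAt using 1
    ring
  have hm := monotoneOn_of_hasDerivWithinAt_nonneg (convex_Icc 0 t)
    (fun s hs => (hd s hs).continuousWithinAt)
    (fun s hs => (hd s (interior_subset hs)).mono interior_subset)
    (fun s hs => by
      have hs' := interior_subset hs
      have h1 := hu s hs'.1 hs'.2
      have h2 : Real.exp (-1 * s) = Real.exp s * Real.exp (-2 * s) := by
        rw [← Real.exp_add]; ring_nf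
      rw [h2]
      have h3 : 0 ≤ Real.exp s * (τ s ξ + u - discrepancy ρ (τ s) ξ
        + M / 2 * Real.exp (-2 * s)) := mul_nonneg (Real.exp_pos _).le (by linarith)
      linarith)
  have h := hm (Set.left_mem_Icc.2 ht) (Set.right_mem_Icc.2 ht) ht
  have h0 := hu 0 le_rfl ht
  have h1 : -M ≤ discrepancy ρ (τ 0) ξ :=
    (abs_le.1 ((discrepancyMap hρ (τ 0)).norm_coe_le_norm ξ)).1
  have h2 : 0 ≤ M / 2 * Real.exp (-1 * t) := by positivity
  simp only [mul_zero, Real.exp_zero, one_mul, mul_one] at h h0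
  have h3 : τ t ξ + u = discrepancy ρ (τ t) ξ := by rw [hu_def]; ring
  rw [h3] at h
  rw [Real.exp_neg, ← div_eq_mul_inv, ← neg_div, div_le_iff₀ (Real.exp_pos _)]
  linarith

/-- The discrepancy decays exponentially along the flow. -/
lemma IsAntipodalFlowSol.norm_discrepancyMap_le (hρ : IsSeparating ρ) {τ : ℝ → C(Z, ℝ)}
    (hτ : IsAntipodalFlowSol ρ τ) {t : ℝ} (ht : 0 ≤ t) :
    ‖discrepancyMap hρ (τ t)‖ ≤ 2 * ‖discrepancyMap hρ (τ 0)‖ * Real.exp (-t) := by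
  refine (ContinuousMap.norm_le _ (by positivity)).2 fun ξ =>
    abs_le.2 ⟨hτ.le_discrepancy hρ ht ξ, (hτ.discrepancy_le hρ ht ξ).trans ?_⟩
  have h : Real.exp (-(2 * t)) ≤ Real.exp (-t) := Real.exp_le_exp.2 (by linarith)
  have h1 := mul_le_mul_of_nonneg_left h (norm_nonneg (discrepancyMap hρ (τ 0)))
  have h2 : 0 ≤ ‖discrepancyMap hρ (τ 0)‖ * Real.exp (-t) := by positivity
  linarith

lemma IsAntipodalFlowSol.norm_sub_le_exp (hρ : IsSeparating ρ) {τ : ℝ → C(Z, ℝ)}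
    (hτ : IsAntipodalFlowSol ρ τ) {s t : ℝ} (hs : 0 ≤ s) (hst : s ≤ t) :
    ‖τ t - τ s‖ ≤ 2 * ‖discrepancyMap hρ (τ 0)‖ * Real.exp (-s) := by
  set C := 2 * ‖discrepancyMap hρ (τ 0)‖
  have hC : 0 ≤ C := by positivity
  have hτ' := (isAntipodalFlowSol_iff hρ).1 hτ
  have h := image_norm_le_of_norm_deriv_right_le_deriv_boundary (f := fun r => τ r - τ s)
    (f' := fun r => -discrepancyMap hρ (τ r)) (a := s) (b := t)
    (B := fun r => C * Real.exp (-s) - C * Real.exp (-r)) (B' := fun r => C * Real.exp (-r))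
    (fun r hr => (((hτ' r (hs.trans hr.1)).continuousWithinAt).mono
      fun x hx => hs.trans hx.1).sub continuousWithinAt_const)
    (fun r hr => ((hτ' r (hs.trans hr.1)).sub_const _).mono
      fun x hx => hs.trans (hr.1.trans hx)) (by simp)
    (fun r => by
      convert! (((hasDerivAt_id r).neg).exp.const_mul C).const_sub (C * Real.exp (-s)) using 1
      simp)
    (fun r hr => by
      rw [norm_neg]
      exact hτ.norm_discrepancyMap_le hρ (hs.trans hr.1)) ⟨hst, le_rfl⟩
  have h1 : 0 ≤ C * Real.exp (-t) := by positivity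
  linarith

lemma IsAntipodalFlowSol.exists_tendsto (hρ : IsSeparating ρ) {τ : ℝ → C(Z, ℝ)}
    (hτ : IsAntipodalFlowSol ρ τ) : ∃ σ : C(Z, ℝ), Tendsto τ atTop (𝓝 σ) := by
  refine cauchySeq_tendsto_of_complete (Metric.cauchySeq_iff'.2 fun ε hε => ?_)
  have hlim : Tendsto (fun t : ℝ => 2 * ‖discrepancyMap hρ (τ 0)‖ * Real.exp (-t)) atTop (𝓝 0) := by
    simpa using Real.tendsto_exp_neg_atTop_nhds_zero.const_mul (2 * ‖discrepancyMap hρ (τ 0)‖)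
  obtain ⟨N, hN, hN0⟩ := ((hlim.eventually_lt_const hε).and (eventually_ge_atTop 0)).exists
  refine ⟨N, fun n hn => ?_⟩
  rw [dist_eq_norm]
  exact (hτ.norm_sub_le_exp hρ hN0 hn).trans_lt hN

lemma IsAntipodalFlowSol.discrepancyMap_limit (hρ : IsSeparating ρ) {τ : ℝ → C(Z, ℝ)}
    (hτ : IsAntipodalFlowSol ρ τ) {σ : C(Z, ℝ)} (hσ : Tendsto τ atTop (𝓝 σ)) :
    discrepancyMap hρ σ = 0 := by
  have h1 := ((lipschitzWith_neg_discrepancyMap hρ).continuous.tendsto σ).comp hσ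
  have hlim : Tendsto (fun t : ℝ => 2 * ‖discrepancyMap hρ (τ 0)‖ * Real.exp (-t)) atTop (𝓝 0) := by
    simpa using Real.tendsto_exp_neg_atTop_nhds_zero.const_mul (2 * ‖discrepancyMap hρ (τ 0)‖)
  have h2 : Tendsto (fun t => -discrepancyMap hρ (τ t)) atTop (𝓝 0) :=
    squeeze_zero_norm' ((eventually_ge_atTop 0).mono fun t ht => by
      rw [norm_neg]
      exact hτ.norm_discrepancyMap_le hρ ht) hlim
  exact neg_eq_zero.1 (tendsto_nhds_unique h1 h2)

/-- The flow line starting at `τ₀`, together with its limit. -/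
lemma exists_flow_limit (hρ : IsSeparating ρ) (τ₀ : C(Z, ℝ)) :
    ∃ p : (ℝ → C(Z, ℝ)) × C(Z, ℝ), p.1 0 = τ₀ ∧ IsAntipodalFlowSol ρ p.1 ∧
      Tendsto p.1 atTop (𝓝 p.2) := by
  obtain ⟨τ, h0, hτ⟩ := exists_isAntipodalFlowSol hρ τ₀
  obtain ⟨σ, hσ⟩ := hτ.exists_tendsto hρ
  exact ⟨(τ, σ), h0, hτ, hσ⟩

/-- The limit of the antipodal flow started at `τ₀`. -/
noncomputable def flowLimit (hρ : IsSeparating ρ) (τ₀ : C(Z, ℝ)) : C(Z, ℝ) :=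
  (exists_flow_limit hρ τ₀).choose.2

lemma antipodalization_eq (hρ : IsSeparating ρ) (τ₀ : C(Z, ℝ)) :
    antipodalization ρ τ₀ = eMap ρ (flowLimit hρ τ₀) :=
  dif_pos (exists_flow_limit hρ τ₀)

lemma discrepancyMap_flowLimit (hρ : IsSeparating ρ) (τ₀ : C(Z, ℝ)) :
    discrepancyMap hρ (flowLimit hρ τ₀) = 0 :=
  (exists_flow_limit hρ τ₀).choose_spec.2.1.discrepancyMap_limit hρ
    (exists_flow_limit hρ τ₀).choose_spec.2.2

lemma norm_flowLimit_sub_le (hρ : IsSeparating ρ) (τ₀ σ₀ : C(Z, ℝ)) :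
    ‖flowLimit hρ τ₀ - flowLimit hρ σ₀‖ ≤ ‖τ₀ - σ₀‖ := by
  obtain ⟨h1, h2, h3⟩ := (exists_flow_limit hρ τ₀).choose_spec
  obtain ⟨k1, k2, k3⟩ := (exists_flow_limit hρ σ₀).choose_spec
  refine le_of_tendsto (h3.sub k3).norm ((eventually_ge_atTop 0).mono fun t ht => ?_)
  exact (h2.norm_sub_le hρ k2 ht).trans_eq (by rw [h1, k1])

/-- Functions of zero discrepancy are fixed by the flow. -/
lemma flowLimit_eq_self (hρ : IsSeparating ρ) {τ₀ : C(Z, ℝ)} (h : discrepancyMap hρ τ₀ = 0) :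
    flowLimit hρ τ₀ = τ₀ := by
  obtain ⟨h1, h2, h3⟩ := (exists_flow_limit hρ τ₀).choose_spec
  have hc : IsAntipodalFlowSol ρ fun _ : ℝ => τ₀ := (isAntipodalFlowSol_iff hρ).2 fun t _ => by
    rw [h, neg_zero]
    exact hasDerivWithinAt_const _ _ _
  refine tendsto_nhds_unique h3 (tendsto_const_nhds.congr' ((eventually_ge_atTop 0).mono
    fun t ht => ?_))
  have := h2.norm_sub_le hρ hc ht
  rw [h1, sub_self, norm_zero] at this
  exact (sub_eq_zero.1 (norm_le_zero_iff.1 this)).symm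

end Flow

/-! ### The geometric mean value theorem -/

section MeanValue

lemma HasFourPoints.nontrivial (h4 : HasFourPoints Z) : Nontrivial Z := by
  obtain ⟨a, b, -, -, hab, -⟩ := h4
  exact ⟨a, b, hab⟩

lemma HasFourPoints.exists_ne_ne (h4 : HasFourPoints Z) (ξ η : Z) : ∃ ζ, ξ ≠ ζ ∧ η ≠ ζ := by
  obtain ⟨a, b, c, -, hab, hac, -, hbc, -⟩ := h4
  by_contra! h
  have ha := h a
  have hb := h b
  have hc := h c
  by_cases ξ = a <;> by_cases ξ = b <;> grind

lemma HasFourPoints.exists_pair (h4 : HasFourPoints Z) (ξ : Z) :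
    ∃ p q : Z, ξ ≠ p ∧ ξ ≠ q ∧ p ≠ q := by
  obtain ⟨p, hp, -⟩ := h4.exists_ne_ne ξ ξ
  obtain ⟨q, hq, hpq⟩ := h4.exists_ne_ne ξ p
  exact ⟨p, q, hp, hq, hpq⟩

lemma MoebiusEquiv.symm {ρ₁ ρ₂ : Z → Z → ℝ} (h : MoebiusEquiv ρ₁ ρ₂) : MoebiusEquiv ρ₂ ρ₁ :=
  fun _ _ _ _ h1 h2 h3 h4 h5 h6 => (h _ _ _ _ h1 h2 h3 h4 h5 h6).symm

lemma MoebiusEquiv.trans {ρ₁ ρ₂ ρ₃ : Z → Z → ℝ} (h : MoebiusEquiv ρ₁ ρ₂)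
    (h' : MoebiusEquiv ρ₂ ρ₃) : MoebiusEquiv ρ₁ ρ₃ :=
  fun _ _ _ _ h1 h2 h3 h4 h5 h6 =>
    (h _ _ _ _ h1 h2 h3 h4 h5 h6).trans (h' _ _ _ _ h1 h2 h3 h4 h5 h6)

variable [TopologicalSpace Z] {ρ ρ' : Z → Z → ℝ}

lemma moebiusEquiv_eMap (ρ : Z → Z → ℝ) (τ : C(Z, ℝ)) : MoebiusEquiv ρ (eMap ρ τ) := by
  intro ξ ξ' η η' _ _ _ _ _ _
  have h (x : Z) : Real.exp (τ x / 2) ≠ 0 := (Real.exp_pos _).ne'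
  have h1 := h ξ
  have h2 := h ξ'
  have h3 := h η
  have h4 := h η'
  rw [crossRatio, crossRatio, ← mul_div_mul_left _ _ (mul_ne_zero (mul_ne_zero h1 h2)
    (mul_ne_zero h3 h4))]
  simp only [eMap]
  ring_nf

lemma eMap_eMap (ρ : Z → Z → ℝ) (τ σ : C(Z, ℝ)) : eMap (eMap ρ τ) σ = eMap ρ (τ + σ) := by
  ext ξ η
  simp only [eMap, ContinuousMap.add_apply, add_div, Real.exp_add]
  ring

lemma eMap_zero (ρ : Z → Z → ℝ) : eMap ρ 0 = ρ := by
  ext ξ η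
  simp [eMap]

lemma eMap_sq (ρ : Z → Z → ℝ) (τ : C(Z, ℝ)) (ξ η : Z) :
    eMap ρ τ ξ η ^ 2 = Real.exp (τ ξ) * Real.exp (τ η) * ρ ξ η ^ 2 := by
  have h (x : ℝ) : Real.exp x = Real.exp (x / 2) ^ 2 := by
    rw [← Real.exp_nat_mul]; congr 1; push_cast; ring
  rw [h (τ ξ), h (τ η), eMap]
  ring

/-- The derivative is determined by the mean value identity. -/
lemma log_mDeriv_eMap (h4 : HasFourPoints Z) (hρ : IsSeparating ρ) (τ : C(Z, ℝ)) (ξ : Z) :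
    Real.log (mDeriv ρ (eMap ρ τ) ξ) = τ ξ := by
  have hex : ∃ f : Z → ℝ, Continuous f ∧ (∀ ξ, 0 < f ξ) ∧
      ∀ ξ η, eMap ρ τ ξ η ^ 2 = f ξ * f η * ρ ξ η ^ 2 :=
    ⟨fun ξ => Real.exp (τ ξ), by fun_prop, fun ξ => Real.exp_pos _, eMap_sq ρ τ⟩
  obtain ⟨-, hpos, heq⟩ := hex.choose_spec
  rw [mDeriv, dif_pos hex]
  set f := hex.choose
  have hadd (x y : Z) (hxy : x ≠ y) : Real.log (f x) + Real.log (f y) = τ x + τ y := by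
    have h1 := heq x y
    have hp := hρ.pos hxy
    rw [eMap_sq] at h1
    have h2 := mul_right_cancel₀ (by positivity) h1
    rw [← Real.log_mul (hpos x).ne' (hpos y).ne', ← h2, ← Real.exp_add, Real.log_exp]
  obtain ⟨p, q, hp, hq, hpq⟩ := h4.exists_pair ξ
  linarith [hadd ξ p hp, hadd ξ q hq, hadd p q hpq]

lemma MoebiusEquiv.log_add_log (h : MoebiusEquiv ρ ρ') (hρ : IsSeparating ρ)
    (hρ' : IsSeparating ρ') {x x' y y' : Z} (h1 : x ≠ x') (h2 : x ≠ y) (h3 : x ≠ y')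
    (h4 : x' ≠ y) (h5 : x' ≠ y') (h6 : y ≠ y') :
    Real.log (ρ' x y) - Real.log (ρ x y) + (Real.log (ρ' x' y') - Real.log (ρ x' y')) =
      Real.log (ρ' x y') - Real.log (ρ x y') + (Real.log (ρ' x' y) - Real.log (ρ x' y)) := by
  have hlog {r : Z → Z → ℝ} (hr : IsSeparating r) : Real.log (crossRatio r x x' y y') =
      Real.log (r x y) + Real.log (r x' y') - (Real.log (r x y') + Real.log (r x' y)) := by
    have k1 := hr.pos h2
    have k2 := hr.pos h3
    have k3 := hr.pos h4
    have k4 := hr.pos h5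
    rw [crossRatio, Real.log_div (by positivity) (by positivity),
      Real.log_mul (by positivity) (by positivity), Real.log_mul (by positivity) (by positivity)]
  have := congrArg Real.log (h x x' y y' h1 h2 h3 h4 h5 h6)
  rw [hlog hρ, hlog hρ'] at this
  linarith

/-- Geometric mean value theorem: Moebius equivalent separating functions differ by a
continuous conformal factor. -/
lemma MoebiusEquiv.exists_eq_eMap (h4 : HasFourPoints Z) [T1Space Z] (hρ : IsSeparating ρ)
    (hρ' : IsSeparating ρ') (h : MoebiusEquiv ρ ρ') : ∃ τ : C(Z, ℝ), ρ' = eMap ρ τ := by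
  set L : Z → Z → ℝ := fun x y => Real.log (ρ' x y) - Real.log (ρ x y) with hL
  have hsymm (x y : Z) : L x y = L y x := by simp only [hL, hρ.symm x y, hρ'.symm x y]
  let G (x p q : Z) : ℝ := L x p + L x q - L p q
  have hGsymm (x p q : Z) : G x p q = G x q p := by
    simp only [G, hsymm p q]
    ring
  have hGstep {x p p' q : Z} (hp : x ≠ p) (hp' : x ≠ p') (hq : x ≠ q) (hpq : p ≠ q)
      (hpq' : p' ≠ q) : G x p q = G x p' q := by
    by_cases hpp : p = p'
    · rw [hpp]
    · have := h.log_add_log hρ hρ' hq hp hp' hpq.symm hpq'.symm hpp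
      simp only [G]
      change L x p + L q p' = L x p' + L q p at this
      rw [hsymm p q, hsymm p' q]
      linarith
  have hG {x p q p' q' : Z} (hp : x ≠ p) (hq : x ≠ q) (hpq : p ≠ q) (hp' : x ≠ p')
      (hq' : x ≠ q') (hpq' : p' ≠ q') : G x p q = G x p' q' := by
    by_cases h1 : p' = q
    · subst h1
      by_cases h2 : q' = p
      · subst h2
        exact hGsymm _ _ _
      · rw [hGstep hp hq' hp' hpq (Ne.symm hpq')]
        exact hGsymm _ _ _
    · rw [hGstep hp hp' hq hpq h1, hGsymm x p' q, hGsymm x p' q']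
      exact hGstep hq hq' hp' (Ne.symm h1) (Ne.symm hpq')
  choose P Q hP hQ hPQ using h4.exists_pair
  let g (x : Z) : ℝ := G x (P x) (Q x)
  have hg {x p q : Z} (hp : x ≠ p) (hq : x ≠ q) (hpq : p ≠ q) : g x = G x p q :=
    hG (hP x) (hQ x) (hPQ x) hp hq hpq
  have hgc : Continuous g := by
    refine continuous_iff_continuousAt.2 fun x => ?_
    have hLc {p : Z} (hp : x ≠ p) : ContinuousAt (fun y => L y p) x := by
      have hc {r : Z → Z → ℝ} (hr : IsSeparating r) :
          ContinuousAt (fun y => Real.log (r y p)) x :=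
        ContinuousAt.log (hr.continuous.comp (Continuous.prodMk_left p)).continuousAt
          (hr.pos hp).ne'
      exact (hc hρ').sub (hc hρ)
    have hGc : ContinuousAt (fun y => G y (P x) (Q x)) x :=
      ((hLc (hP x)).add (hLc (hQ x))).sub continuousAt_const
    refine hGc.congr ?_
    filter_upwards [isOpen_ne.mem_nhds (hP x), isOpen_ne.mem_nhds (hQ x)] with y hy1 hy2
    exact (hg hy1 hy2 (hPQ x)).symm
  refine ⟨⟨g, hgc⟩, ?_⟩
  have hs := isSeparating_eMap hρ ⟨g, hgc⟩
  ext x y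
  by_cases hxy : x = y
  · rw [(hs.eq_zero_iff x y).2 hxy, (hρ'.eq_zero_iff x y).2 hxy]
  · obtain ⟨r, hxr, hyr⟩ := h4.exists_ne_ne x y
    have hsum : g x + g y = 2 * L x y := by
      rw [hg hxy hxr hyr, hg (Ne.symm hxy) hyr hxr]
      simp only [G, hsymm y x]
      ring
    have h1 := hρ.pos hxy
    have h2 := hρ'.pos hxy
    change ρ' x y = Real.exp (g x / 2) * Real.exp (g y / 2) * ρ x y
    rw [← Real.exp_add, ← add_div, hsum, mul_div_cancel_left₀ _ two_ne_zero, hL, Real.exp_sub,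
      Real.exp_log h1, Real.exp_log h2, div_mul_cancel₀ _ h1.ne']

/-- In terms of conformal factors, `d_M` is the supremum distance. -/
lemma dM_eMap_eMap (h4 : HasFourPoints Z) [CompactSpace Z] (hρ : IsSeparating ρ)
    (τ σ : C(Z, ℝ)) : dM (eMap ρ τ) (eMap ρ σ) = ‖σ - τ‖ := by
  have h : eMap ρ σ = eMap (eMap ρ τ) (σ - τ) := by rw [eMap_eMap, add_sub_cancel]
  rw [dM, h, ContinuousMap.norm_eq_iSup_norm]
  simp only [log_mDeriv_eMap h4 (isSeparating_eMap hρ τ), Real.norm_eq_abs]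

end MeanValue

theorem statement10 [TopologicalSpace Z] [CompactSpace Z]
    [TopologicalSpace.MetrizableSpace Z] (h4 : HasFourPoints Z)
    (ρ₀ : Z → Z → ℝ) (h₀ : IsAntipodal ρ₀)
    (ρ₁ : Z → Z → ℝ) (hρ₁ : ρ₁ ∈ MoebiusSpace ρ₀) :
    ∃ H : MoebiusSpace ρ₀ → ℝ → MoebiusSpace ρ₀,
      (∀ (ρ : MoebiusSpace ρ₀) (t : ℝ) (g : C(Z, ℝ)),
        (∀ ξ, g ξ = Real.log (mDeriv ρ₁ ρ.1 ξ)) →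
        (H ρ t).1 = antipodalization ρ₁ (t • g)) ∧
      (∀ ρ : MoebiusSpace ρ₀, H ρ 1 = ρ) ∧
      (∀ ρ : MoebiusSpace ρ₀, (H ρ 0).1 = ρ₁) ∧
      (∀ (ρ : MoebiusSpace ρ₀) (t : ℝ), t ∈ Set.Icc (0 : ℝ) 1 → ∀ ε > (0 : ℝ),
        ∃ δ > (0 : ℝ), ∀ (ρ' : MoebiusSpace ρ₀) (t' : ℝ), t' ∈ Set.Icc (0 : ℝ) 1 →
          dM ρ.1 ρ'.1 < δ → |t' - t| < δ → dM (H ρ t).1 (H ρ' t').1 < ε) := by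
  have := h4.nontrivial
  have hρ : IsSeparating ρ₁ := hρ₁.1.toIsSeparating
  have hex (ρ : MoebiusSpace ρ₀) : ∃ τ : C(Z, ℝ), ρ.1 = eMap ρ₁ τ :=
    (hρ₁.2.symm.trans ρ.2.2).exists_eq_eMap h4 hρ ρ.2.1.toIsSeparating
  choose G hG using hex
  have hGlog (ρ : MoebiusSpace ρ₀) (ξ : Z) : Real.log (mDeriv ρ₁ ρ.1 ξ) = G ρ ξ := by
    conv_lhs => rw [hG ρ]
    exact log_mDeriv_eMap h4 hρ _ ξ
  have hmem (τ : C(Z, ℝ)) : eMap ρ₁ (flowLimit hρ τ) ∈ MoebiusSpace ρ₀ :=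
    ⟨(isAntipodal_eMap_iff hρ _).2 (discrepancyMap_flowLimit hρ τ),
      hρ₁.2.trans (moebiusEquiv_eMap ρ₁ _)⟩
  refine ⟨fun ρ t => ⟨eMap ρ₁ (flowLimit hρ (t • G ρ)), hmem _⟩, fun ρ t g hg => ?_, fun ρ => ?_,
    fun ρ => ?_, fun ρ t _ ε hε => ?_⟩
  · have : g = G ρ := ContinuousMap.ext fun ξ => (hg ξ).trans (hGlog ρ ξ)
    rw [this, antipodalization_eq hρ]
  · have hfix : discrepancyMap hρ (G ρ) = 0 := (isAntipodal_eMap_iff hρ _).1 (hG ρ ▸ ρ.2.1)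
    exact Subtype.ext (by simp only [one_smul, flowLimit_eq_self hρ hfix, ← hG ρ])
  · have hfix : discrepancyMap hρ 0 = 0 :=
      (isAntipodal_eMap_iff hρ _).1 ((eMap_zero ρ₁).symm ▸ hρ₁.1)
    simp only [zero_smul, flowLimit_eq_self hρ hfix, eMap_zero]
  · have hpos : 0 < ‖G ρ‖ + 2 := by positivity
    refine ⟨ε / (‖G ρ‖ + 2), by positivity, fun ρ' t' ht' hd htt => ?_⟩
    rw [hG ρ, hG ρ', dM_eMap_eMap h4 hρ] at hd
    rw [dM_eMap_eMap h4 hρ]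
    have hsplit : t' • G ρ' - t • G ρ = t' • (G ρ' - G ρ) + (t' - t) • G ρ := by module
    have h1 : ‖t' • (G ρ' - G ρ)‖ ≤ ‖G ρ' - G ρ‖ := by
      rw [norm_smul, Real.norm_of_nonneg ht'.1]
      exact mul_le_of_le_one_left (norm_nonneg _) ht'.2
    have h2 : ‖(t' - t) • G ρ‖ ≤ ε / (‖G ρ‖ + 2) * ‖G ρ‖ := by
      rw [norm_smul, Real.norm_eq_abs]
      gcongr
    calc ‖flowLimit hρ (t' • G ρ') - flowLimit hρ (t • G ρ)‖
        ≤ ‖t' • G ρ' - t • G ρ‖ := norm_flowLimit_sub_le hρ _ _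
      _ ≤ ‖t' • (G ρ' - G ρ)‖ + ‖(t' - t) • G ρ‖ := hsplit ▸ norm_add_le _ _
      _ < ε / (‖G ρ‖ + 2) * (‖G ρ‖ + 2) := by
        have : 0 < ε / (‖G ρ‖ + 2) := by positivity
        linarith
      _ = ε := div_mul_cancel₀ _ hpos.ne'
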